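/- Let H ≥ 1 be an integer, α ∈ [0,1], and H_α := Σ_{t=0}^{H−1} α^{2t}. Define the H×H real matrix C by C(i,j) = H_α^{−1} Σ_{t=max(i,j)}^{H} α^{2t−i−j}, and define the H×H tridiagonal matrix T by T(1,1) = 1, T(i,i) = 1 + α² for 2 ≤ i ≤ H, T(i,i+1) = T(i+1,i) = −α for 1 ≤ i ≤ H−1, and all other entries 0. Then C · (H_α · T) = I_H and (H_α · T) · C = I_H; in particular C is invertible with C^{−1} = H_α · T. -/

import Mathlib

open Finset Matrix

/-- Effective history horizon `H_α = ∑_{t=0}^{H-1} α^{2t}`. -/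
noncomputable def effHorizon (H : ℕ) (α : ℝ) : ℝ := ∑ t ∈ Finset.range H, α ^ (2 * t)

/-- The dense block of the Gram matrix of the truncated discounted vectors:
`C(i,j) = H_α⁻¹ ∑_{t=max(i,j)}^{H} α^(2t-i-j)` for `i, j ∈ {1, …, H}`
(here `i j : Fin H` are `0`-indexed, so `i` stands for `i+1`). -/
noncomputable def gramBlock (H : ℕ) (α : ℝ) : Matrix (Fin H) (Fin H) ℝ := fun i j =>
  (effHorizon H α)⁻¹ *
    ∑ t ∈ Finset.Icc (max ((i : ℕ) + 1) ((j : ℕ) + 1)) H, α ^ (2 * t - ((i : ℕ) + 1) - ((j : ℕ) + 1))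

/-- The tridiagonal matrix `T` with `T(1,1) = 1`, `T(i,i) = 1 + α²` for `i ≥ 2`,
`T(i,i+1) = T(i+1,i) = -α`, and all other entries `0`. -/
noncomputable def triDiag (H : ℕ) (α : ℝ) : Matrix (Fin H) (Fin H) ℝ := fun i j =>
  if i = j then (if (i : ℕ) = 0 then 1 else 1 + α ^ 2)
  else if (i : ℕ) + 1 = (j : ℕ) ∨ (j : ℕ) + 1 = (i : ℕ) then -α
  else 0

/-- The upper shift matrix, with ones on the first superdiagonal. -/
def upperShift (H : ℕ) : Matrix (Fin H) (Fin H) ℝ := fun i j =>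
  if (i : ℕ) + 1 = (j : ℕ) then 1 else 0

/-- The upper triangular matrix of powers `α^(j-i)`, `i ≤ j`. -/
noncomputable def upperPowers (H : ℕ) (α : ℝ) : Matrix (Fin H) (Fin H) ℝ := fun i j =>
  if (i : ℕ) ≤ (j : ℕ) then α ^ ((j : ℕ) - (i : ℕ)) else 0

theorem upperShift_mul_apply {H : ℕ} (M : Matrix (Fin H) (Fin H) ℝ) (i j : Fin H) :
    (upperShift H * M) i j = if h : (i : ℕ) + 1 < H then M ⟨i + 1, h⟩ j else 0 := by
  rw [Matrix.mul_apply]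
  split_ifs with h
  · rw [Finset.sum_eq_single ⟨i + 1, h⟩]
    · simp [upperShift]
    · intro k _ hk
      have : ¬ (i : ℕ) + 1 = k := fun e => hk (Fin.ext e.symm)
      simp [upperShift, this]
    · simp
  · refine Finset.sum_eq_zero fun k _ => ?_
    have : ¬ (i : ℕ) + 1 = k := by have := k.isLt; omega
    simp [upperShift, this]

theorem one_sub_smul_upperShift_mul_upperPowers (H : ℕ) (α : ℝ) :
    (1 - α • upperShift H) * upperPowers H α = 1 := by
  ext i j
  rw [sub_mul, one_mul, smul_mul_assoc, Matrix.sub_apply, Matrix.smul_apply,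
    upperShift_mul_apply, Matrix.one_apply]
  have hj := j.isLt
  rcases lt_trichotomy (i : ℕ) j with h | h | h
  · have hi : (i : ℕ) + 1 < H := by omega
    have e : (j : ℕ) - i = (j - (i + 1)) + 1 := by omega
    have hne : i ≠ j := fun e => h.ne (congrArg _ e)
    have h' : (i : ℕ) + 1 ≤ j := h
    simp only [hi, upperPowers, h.le, h', hne, if_true, if_false, dif_pos, smul_eq_mul]
    rw [e, pow_succ]
    ring
  · obtain rfl : i = j := Fin.ext h
    simp [upperPowers]
  · have hne : i ≠ j := fun e => h.ne' (congrArg _ e)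
    have h1 : ¬ (i : ℕ) ≤ j := by omega
    have h2 : ¬ (i : ℕ) + 1 ≤ j := by omega
    simp [upperPowers, h1, h2, hne]

theorem transpose_upperShift_mul_self (H : ℕ) :
    (upperShift H)ᵀ * upperShift H = Matrix.diagonal fun i : Fin H => if (i : ℕ) = 0 then 0 else 1 := by
  ext i j
  rw [Matrix.mul_apply, Matrix.diagonal_apply]
  have hi := i.isLt
  by_cases h0 : (i : ℕ) = 0
  · simp [upperShift, h0]
  · rw [Finset.sum_eq_single ⟨i - 1, by omega⟩]
    · have e : (i : ℕ) - 1 + 1 = i := by omega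
      simp [upperShift, e, h0, Fin.ext_iff]
    · intro k _ hk
      have : ¬ (k : ℕ) + 1 = i := fun e => hk (Fin.ext (by simp; omega))
      simp [upperShift, this]
    · simp

theorem triDiag_eq_transpose_mul (H : ℕ) (α : ℝ) :
    triDiag H α = (1 - α • upperShift H)ᵀ * (1 - α • upperShift H) := by
  have h : (1 - α • upperShift H)ᵀ * (1 - α • upperShift H) =
      1 - α • upperShift H - α • (upperShift H)ᵀ
        + α ^ 2 • ((upperShift H)ᵀ * upperShift H) := by
    rw [Matrix.transpose_sub, Matrix.transpose_one, Matrix.transpose_smul, sub_mul, mul_sub,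
      one_mul, one_mul, mul_sub, mul_one, smul_mul_smul_comm, sq]
    abel
  rw [h, transpose_upperShift_mul_self]
  ext i j
  simp only [triDiag, Matrix.add_apply, Matrix.sub_apply, Matrix.smul_apply, Matrix.one_apply,
    Matrix.diagonal_apply, Matrix.transpose_apply, upperShift, smul_eq_mul, Fin.ext_iff]
  split_ifs <;> first | omega | ring

theorem gramBlock_eq_smul (H : ℕ) (α : ℝ) :
    gramBlock H α = (effHorizon H α)⁻¹ • (upperPowers H α * (upperPowers H α)ᵀ) := by
  ext i j
  rw [Matrix.smul_apply, Matrix.mul_apply, smul_eq_mul, gramBlock]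
  congr 1
  simp only [Matrix.transpose_apply, upperPowers]
  rw [Fin.sum_univ_eq_sum_range (fun t => (if (i : ℕ) ≤ t then α ^ (t - (i : ℕ)) else 0) *
    (if (j : ℕ) ≤ t then α ^ (t - (j : ℕ)) else 0)) H]
  have hIco : Finset.Icc (max ((i : ℕ) + 1) ((j : ℕ) + 1)) H =
      (Finset.Ico (max (i : ℕ) j) H).map (addRightEmbedding 1) := by
    rw [Finset.map_add_right_Ico]
    ext t
    simp only [Finset.mem_Icc, Finset.mem_Ico]
    omega
  rw [hIco, Finset.sum_map]
  have hsub : Finset.Ico (max (i : ℕ) j) H ⊆ Finset.range H := fun t ht => by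
    rw [Finset.mem_Ico] at ht
    exact Finset.mem_range.2 ht.2
  refine Finset.sum_subset_zero_on_sdiff hsub ?_ ?_
  · intro t ht
    rw [Finset.mem_sdiff, Finset.mem_range, Finset.mem_Ico] at ht
    have : ¬ (i : ℕ) ≤ t ∨ ¬ (j : ℕ) ≤ t := by omega
    rcases this with h | h <;> simp [h]
  · intro t ht
    rw [Finset.mem_Ico] at ht
    have h1 : (i : ℕ) ≤ t := by omega
    have h2 : (j : ℕ) ≤ t := by omega
    rw [if_pos h1, if_pos h2, ← pow_add, addRightEmbedding_apply]
    congr 1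
    omega

theorem effHorizon_pos {H : ℕ} (hH : 1 ≤ H) (α : ℝ) : 0 < effHorizon H α := by
  refine Finset.sum_pos' (fun t _ => (even_two_mul t).pow_nonneg α)
    ⟨0, Finset.mem_range.2 hH, by simp⟩

/-- The explicit tridiagonal inverse of the Gram-block matrix `C`:
`C ⬝ (H_α T) = I`, `(H_α T) ⬝ C = I`, and in particular `C⁻¹ = H_α T`. -/
theorem gramBlock_inverse (H : ℕ) (hH : 1 ≤ H) (α : ℝ) (hα : α ∈ Set.Icc (0 : ℝ) 1) :
    gramBlock H α * (effHorizon H α • triDiag H α) = 1 ∧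
    (effHorizon H α • triDiag H α) * gramBlock H α = 1 ∧
    (gramBlock H α)⁻¹ = effHorizon H α • triDiag H α := by
  have hLB := one_sub_smul_upperShift_mul_upperPowers H α
  have hinv : gramBlock H α * (effHorizon H α • triDiag H α) = 1 := by
    rw [gramBlock_eq_smul, triDiag_eq_transpose_mul, smul_mul_smul_comm,
      inv_mul_cancel₀ (effHorizon_pos hH α).ne', one_smul, Matrix.mul_assoc,
      ← Matrix.mul_assoc (upperPowers H α)ᵀ, ← Matrix.transpose_mul, hLB,
      Matrix.transpose_one, Matrix.one_mul]
    exact mul_eq_one_comm.1 hLB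
  exact ⟨hinv, mul_eq_one_comm.1 hinv, Matrix.inv_eq_right_inv hinv⟩
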